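/- Assume f is continuously differentiable on an open set containing Ω, (x^k, d^k, α_k) is an Algorithm-2.1 sequence in which, for each k, there is a unit vector v^k ∈ ℝⁿ (‖v^k‖ = 1) such that d^k minimizes ⟨v^k, d⟩ over {d ∈ ℝⁿ : ‖d‖ ≤ Δ and x^k + d ∈ Ω}. Let η = ∑_{k=0}^∞ η_k, and assume the level set {x ∈ ℝⁿ : f(x) ≤ f(x^0) + η} is bounded, and that there exists an infinite set of indices K₁ ⊆ ℕ such that ∇f(x^k) ≠ 0 for k ∈ K₁ and ‖v^k − ∇f(x^k)/‖∇f(x^k)‖‖ → 0 along K₁. Then for every ε > 0, either there exists an index k with f(x^k) ≤ f_target + ε, or there exists a limit point x_* of the sequence (x^k)_{k ∈ K₁} such that ⟨∇f(x_*), d⟩ ≥ 0 for all d ∈ ℝⁿ with x_* + d ∈ Ω. -/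

import Mathlib

open Filter Topology InnerProductSpace

/-- A nonnegative directional limit of difference quotients: if `f` increases along the steps
`t k • d k` up to an error that is `o(t k)`, then the derivative in the limit direction is
nonnegative. -/
theorem HasStrictFDerivAt.nonneg_of_tendsto {ι E : Type*} [NormedAddCommGroup E]
    [NormedSpace ℝ E] {l : Filter ι} [l.NeBot] {f : E → ℝ} {f' : E →L[ℝ] ℝ} {x₀ d₀ : E}
    (hf : HasStrictFDerivAt f f' x₀) {x d : ι → E} {t e : ι → ℝ}
    (hx : Tendsto x l (𝓝 x₀)) (hd : Tendsto d l (𝓝 d₀)) (ht : Tendsto t l (𝓝 0))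
    (he : Tendsto e l (𝓝 0)) (htpos : ∀ᶠ k in l, 0 < t k)
    (hinc : ∀ᶠ k in l, f (x k) - t k * e k ≤ f (x k + t k • d k)) : 0 ≤ f' d₀ := by
  have hpair : Tendsto (fun k => (x k + t k • d k, x k)) l (𝓝 (x₀, x₀)) := by
    refine Tendsto.prodMk_nhds ?_ hx
    simpa using hx.add (ht.smul hd)
  have ho : (fun k => f (x k + t k • d k) - f (x k) - f' (t k • d k)) =o[l] t := by
    have h1 : (fun k => f (x k + t k • d k) - f (x k) - f' (t k • d k)) =o[l]
        fun k => t k • d k := by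
      simpa [Function.comp_def] using hf.isLittleO.comp_tendsto hpair
    refine h1.trans_isBigO ?_
    simpa using (Asymptotics.isBigO_refl t l).smul (hd.isBigO_one ℝ)
  have hlim : Tendsto (fun k => f' (d k)
      + (f (x k + t k • d k) - f (x k) - f' (t k • d k)) / t k + e k) l (𝓝 (f' d₀)) := by
    simpa using (((f'.continuous.tendsto d₀).comp hd).add ho.tendsto_div_nhds_zero).add he
  refine ge_of_tendsto hlim ?_
  filter_upwards [htpos, hinc] with k hk hk'
  have : f' (d k) + (f (x k + t k • d k) - f (x k) - f' (t k • d k)) / t k + e k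
      = (f (x k + t k • d k) - (f (x k) - t k * e k)) / t k := by
    rw [map_smul, smul_eq_mul]
    field_simp
    ring
  rw [this]
  exact div_nonneg (sub_nonneg.2 hk') hk.le

/-- Limits of minimizers of linear functionals over trust regions: if the limit functional is
nonnegative at the limit minimizer, it is nonnegative in every feasible direction. -/
theorem Convex.inner_nonneg_of_tendsto_argmin {ι E : Type*} [NormedAddCommGroup E]
    [InnerProductSpace ℝ E] {l : Filter ι} [l.NeBot] {Ω : Set E} (hΩ : Convex ℝ Ω) {Δ : ℝ}
    (hΔ : 0 < Δ) {x d v : ι → E} {x₀ d₀ v₀ : E} (hx₀ : x₀ ∈ Ω)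
    (hx : Tendsto x l (𝓝 x₀)) (hd : Tendsto d l (𝓝 d₀)) (hv : Tendsto v l (𝓝 v₀))
    (hmin : ∀ k, ∀ d' : E, ‖d'‖ ≤ Δ → x k + d' ∈ Ω → ⟪v k, d k⟫_ℝ ≤ ⟪v k, d'⟫_ℝ)
    (h₀ : 0 ≤ ⟪v₀, d₀⟫_ℝ) {w : E} (hw : x₀ + w ∈ Ω) : 0 ≤ ⟪v₀, w⟫_ℝ := by
  obtain ⟨s, hs0, hs1, hsw⟩ : ∃ s : ℝ, 0 < s ∧ s ≤ 1 ∧ ‖s • w‖ < Δ := by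
    have h1 : Tendsto (fun s : ℝ => ‖s • w‖) (𝓝[>] 0) (𝓝 0) := by
      have : Continuous fun s : ℝ => ‖s • w‖ := by fun_prop
      simpa using (this.tendsto 0).mono_left nhdsWithin_le_nhds
    have h2 : ∀ᶠ s : ℝ in 𝓝[>] 0, s ≤ 1 :=
      ((gt_mem_nhds one_pos).filter_mono nhdsWithin_le_nhds).mono fun _ h => le_of_lt h
    obtain ⟨s, ha, hb, hc⟩ :=
      ((h1.eventually_lt_const hΔ).and (h2.and self_mem_nhdsWithin)).exists
    exact ⟨s, hc, hb, ha⟩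
  have hmem : x₀ + s • w ∈ Ω := hΩ.add_smul_mem hx₀ hw ⟨hs0.le, hs1⟩
  have hstep : Tendsto (fun k => x₀ + s • w - x k) l (𝓝 (s • w)) := by
    simpa using (tendsto_const_nhds (x := x₀ + s • w)).sub hx
  have hle : ⟪v₀, d₀⟫_ℝ ≤ ⟪v₀, s • w⟫_ℝ := by
    refine le_of_tendsto_of_tendsto (hv.inner hd) (hv.inner hstep) ?_
    filter_upwards [hstep.norm.eventually_lt_const hsw] with k hk
    exact hmin k _ hk.le (by simpa using hmem)
  rw [inner_smul_right] at hle
  exact nonneg_of_mul_nonneg_right (h₀.trans hle) hs0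

/-- A sequence that is bounded below and decreases by `b k`, up to summable errors `η k`, at each
step has summable decreases. -/
theorem summable_of_le_add_sub {a b η : ℕ → ℝ} {c : ℝ} (hη : ∀ k, 0 ≤ η k) (hηs : Summable η)
    (hb : ∀ k, 0 ≤ b k) (hc : ∀ k, c ≤ a k) (h : ∀ k, a (k + 1) ≤ a k + η k - b k) :
    Summable b := by
  have key : ∀ k, a k ≤ a 0 + ∑ i ∈ Finset.range k, η i - ∑ i ∈ Finset.range k, b i := by
    intro k
    induction k with
    | zero => simp
    | succ k ih =>
      rw [Finset.sum_range_succ, Finset.sum_range_succ]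
      linarith [h k]
  refine summable_of_sum_range_le (c := a 0 + ∑' k, η k - c) hb fun k => ?_
  linarith [key k, hc k, hηs.sum_le_tsum (Finset.range k) fun i _ => hη i]

/-- A sequence increasing by at most `η k` at each step is bounded by its initial value plus the
total sum of the `η k`. -/
theorem le_add_tsum_of_le_add {a η : ℕ → ℝ} (hη : ∀ k, 0 ≤ η k) (hηs : Summable η)
    (h : ∀ k, a (k + 1) ≤ a k + η k) (k : ℕ) : a k ≤ a 0 + ∑' i, η i := by
  have key : a k ≤ a 0 + ∑ i ∈ Finset.range k, η i := by
    induction k with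
    | zero => simp
    | succ k ih =>
      rw [Finset.sum_range_succ]
      linarith [h k]
  linarith [hηs.sum_le_tsum (Finset.range k) fun i _ => hη i]

/-- Theorem 2.5: under boundedness of the level set
`{x : f(x) ≤ f(x⁰) + ∑ ηₖ}` and gradient-alignment of the `vᵏ` along an
infinite index set `K₁`, for every `ε > 0`, either some iterate satisfies
`f(xᵏ) ≤ f_target + ε`, or some limit point `x∗` of `(xᵏ)_{k ∈ K₁}` satisfies
`⟨∇f(x∗), d⟩ ≥ 0` for all `d` with `x∗ + d ∈ Ω`. -/
theorem alg21_global_convergence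
    (n : ℕ) (Ω : Set (EuclideanSpace ℝ (Fin n))) (hΩc : IsClosed Ω) (hΩconv : Convex ℝ Ω)
    (f : EuclideanSpace ℝ (Fin n) → ℝ)
    (ftarget Δ γ : ℝ) (hΔ : 0 < Δ) (hγ : γ ∈ Set.Ioo (0 : ℝ) 1)
    (η : ℕ → ℝ) (hηpos : ∀ k, 0 < η k) (hηsum : Summable η)
    (x d : ℕ → EuclideanSpace ℝ (Fin n)) (α : ℕ → ℝ)
    (hxΩ : ∀ k, x k ∈ Ω)
    (hd : ∀ k, ‖d k‖ ≤ Δ) (hdΩ : ∀ k, x k + d k ∈ Ω)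
    (hα : ∀ k, α k ∈ Set.Ioc (0 : ℝ) 1)
    (hdec : ∀ k, f (x k + α k • d k) ≤
      f (x k) + η k - γ * (α k) ^ 2 * (f (x k) - ftarget))
    (hrej : ∀ k, α k = 1 ∨
      f (x k + (2 * α k) • d k) >
        f (x k) + η k - γ * (2 * α k) ^ 2 * (f (x k) - ftarget))
    (hmono : ∀ k, f (x (k + 1)) ≤ f (x k + α k • d k))
    (U : Set (EuclideanSpace ℝ (Fin n))) (hU : IsOpen U) (hΩU : Ω ⊆ U)
    (hf : ContDiffOn ℝ 1 f U)
    (v : ℕ → EuclideanSpace ℝ (Fin n)) (hv : ∀ k, ‖v k‖ = 1)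
    (hdmin : ∀ k, ∀ d' : EuclideanSpace ℝ (Fin n), ‖d'‖ ≤ Δ → x k + d' ∈ Ω →
      ⟪ v k, d k ⟫_ℝ ≤ ⟪ v k, d' ⟫_ℝ)
    (hlevel : Bornology.IsBounded {y : EuclideanSpace ℝ (Fin n) |
      f y ≤ f (x 0) + ∑' k, η k})
    (K : Set ℕ) (hK : K.Infinite)
    (hgrad : ∀ k ∈ K, gradient f (x k) ≠ 0)
    (hvconv : Tendsto (fun k => ‖v k - ‖gradient f (x k)‖⁻¹ • gradient f (x k)‖)
      (atTop ⊓ 𝓟 K) (𝓝 0)) :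
    ∀ ε > 0, (∃ k, f (x k) ≤ ftarget + ε) ∨
      ∃ xstar : EuclideanSpace ℝ (Fin n),
        MapClusterPt xstar (atTop ⊓ 𝓟 K) x ∧
        ∀ dd : EuclideanSpace ℝ (Fin n), xstar + dd ∈ Ω →
          0 ≤ ⟪ gradient f xstar, dd ⟫_ℝ := by
  intro ε hε
  by_cases hex : ∃ k, f (x k) ≤ ftarget + ε
  · exact Or.inl hex
  right
  push Not at hex
  have hstep : ∀ k, f (x (k + 1)) ≤ f (x k) + η k - γ * ε * α k ^ 2 := fun k => by
    have : γ * α k ^ 2 * ε ≤ γ * α k ^ 2 * (f (x k) - ftarget) :=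
      mul_le_mul_of_nonneg_left (by linarith [hex k]) (mul_nonneg hγ.1.le (sq_nonneg _))
    linarith [hmono k, hdec k]
  have hγε : 0 < γ * ε := mul_pos hγ.1 hε
  have hb : ∀ k, 0 ≤ γ * ε * α k ^ 2 := fun k => mul_nonneg hγε.le (sq_nonneg _)
  have hαlim : Tendsto α atTop (𝓝 0) := by
    have h1 : Summable fun k => γ * ε * α k ^ 2 :=
      summable_of_le_add_sub (fun k => (hηpos k).le) hηsum hb (fun k => (hex k).le) hstep
    have h2 := ((summable_mul_left_iff hγε.ne').1 h1).tendsto_atTop_zero.sqrt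
    simpa [Real.sqrt_sq (hα _).1.le] using h2
  have hxlevel : ∀ k, f (x k) ≤ f (x 0) + ∑' k, η k :=
    le_add_tsum_of_le_add (a := fun k => f (x k)) (fun k => (hηpos k).le) hηsum
      fun k => by linarith [hstep k, hb k]
  have : (atTop ⊓ 𝓟 K : Filter ℕ).NeBot := by
    rw [← frequently_mem_iff_neBot]
    exact Nat.frequently_atTop_iff_infinite.2 hK
  let l : Ultrafilter ℕ := Ultrafilter.of (atTop ⊓ 𝓟 K)
  have hl : (l : Filter ℕ) ≤ atTop ⊓ 𝓟 K := Ultrafilter.of_le _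
  have hlK : ∀ᶠ k in (l : Filter ℕ), k ∈ K := hl.trans inf_le_right (mem_principal_self K)
  obtain ⟨x₀, -, hx⟩ := hlevel.isCompact_closure.ultrafilter_le_nhds' (l.map x)
    (Ultrafilter.mem_map.2 <| Filter.univ_mem' fun k => subset_closure (hxlevel k))
  obtain ⟨d₀, -, hd₀⟩ := (isCompact_closedBall (0 : EuclideanSpace ℝ (Fin n))
    Δ).ultrafilter_le_nhds' (l.map d)
    (Ultrafilter.mem_map.2 <| Filter.univ_mem' fun k => by simpa using hd k)
  replace hx : Tendsto x l (𝓝 x₀) := hx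
  replace hd₀ : Tendsto d l (𝓝 d₀) := hd₀
  have hx₀ : x₀ ∈ Ω := hΩc.mem_of_tendsto hx (Filter.Eventually.of_forall hxΩ)
  refine ⟨x₀, mapClusterPt_iff_ultrafilter.2 ⟨l, hl, hx⟩, fun w hw => ?_⟩
  have hC : ContDiffAt ℝ 1 f x₀ := hf.contDiffAt (hU.mem_nhds (hΩU hx₀))
  have hgcont : ContinuousAt (gradient f) x₀ :=
    (LinearIsometryEquiv.continuous _).continuousAt.comp
      (hC.fderiv_right (m := 0) (by simp)).continuousAt
  rcases eq_or_ne (gradient f x₀) 0 with h0 | h0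
  · simp [h0]
  have hglim : Tendsto (fun k => gradient f (x k)) l (𝓝 (gradient f x₀)) := hgcont.tendsto.comp hx
  have hvlim : Tendsto v l (𝓝 (‖gradient f x₀‖⁻¹ • gradient f x₀)) := by
    have h1 := tendsto_zero_iff_norm_tendsto_zero.2 (hvconv.mono_left hl)
    have h2 := (hglim.norm.inv₀ (norm_ne_zero_iff.2 h0)).smul hglim
    simpa using h1.add h2
  have hαl : Tendsto α l (𝓝 0) := hαlim.mono_left (hl.trans inf_le_left)
  have hfl : Tendsto (fun k => f (x k)) l (𝓝 (f x₀)) := hC.continuousAt.tendsto.comp hx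
  have hdir : 0 ≤ fderiv ℝ f x₀ d₀ := by
    refine (hC.hasStrictFDerivAt (by simp)).nonneg_of_tendsto hx hd₀
      (t := fun k => 2 * α k) (e := fun k => γ * (2 * α k) * (f (x k) - ftarget)) ?_ ?_ ?_ ?_
    · simpa using hαl.const_mul 2
    · simpa using ((hαl.const_mul 2).const_mul γ).mul (hfl.sub_const ftarget)
    · exact Filter.Eventually.of_forall fun k => mul_pos two_pos (hα k).1
    · filter_upwards [hαl.eventually_lt_const one_pos] with k hk
      have := (hrej k).resolve_left hk.ne
      nlinarith [hηpos k]
  have hgd : 0 ≤ ⟪gradient f x₀, d₀⟫_ℝ := by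
    simpa [gradient] using hdir
  have hpos : 0 < ‖gradient f x₀‖⁻¹ := inv_pos.2 (norm_pos_iff.2 h0)
  have hfin := hΩconv.inner_nonneg_of_tendsto_argmin hΔ hx₀ hx hd₀ hvlim hdmin
    (by rw [real_inner_smul_left]; exact mul_nonneg hpos.le hgd) hw
  rw [real_inner_smul_left] at hfin
  exact nonneg_of_mul_nonneg_right hfin hpos
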